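/- Let 1 ≤ m ≤ n be integers and let (ℐ, (I_α, J_α)_{α∈ℐ}, (c_α)_{α∈ℐ}) be a quadratic expression over Gr(m,m+n). Let I := (I_α ∪ J_α) ∖ (I_α ∩ J_α) (this set is independent of α since the multiset unions coincide) and 2η := |I|. Then ∑_{α∈ℐ} c_α Δ_{I_α}(𝒜) Δ_{J_α}(𝒜) ≥ 0 for every full-rank (m+n)×m real matrix 𝒜 with all Plücker coordinates nonnegative if and only if ∑_{α∈ℐ(P)} c_α ≥ 0 for every partition P of I compatible with a 321-avoiding permutation. -/

import Mathlib

open Finset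

/-- The Plücker coordinate `Δ_I(A)`: the determinant of the `m × m` submatrix of `A`
whose rows are indexed by `I` in increasing order (and all `m` columns);
junk value `0` when `I` does not have `m` elements. -/
noncomputable def pluck {N m : ℕ} (A : Matrix (Fin N) (Fin m) ℝ) (I : Finset (Fin N)) : ℝ :=
  if h : I.card = m then (A.submatrix (fun k => ((I.orderIsoOfFin h) k : Fin N)) id).det else 0

/-- `u` and `v` are consecutive in `S`: both belong to `S`, are distinct, and no element of `S`
lies strictly between them. -/
def ConsecIn {N : ℕ} (S : Finset (Fin N)) (u v : Fin N) : Prop :=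
  u ∈ S ∧ v ∈ S ∧ u ≠ v ∧ ∀ w ∈ S, ¬(min u v < w ∧ w < max u v)

/-- A list of two-element blocks enumerates a partition of `S` compatible with a
321-avoiding permutation: each successive block consists of two elements consecutive in
what remains of `S`, and the blocks exhaust `S`. -/
def Compat {N : ℕ} : Finset (Fin N) → List (Fin N × Fin N) → Prop
  | S, [] => S = ∅
  | S, p :: rest => ConsecIn S p.1 p.2 ∧ Compat (S \ {p.1, p.2}) rest

/-- `ℐ(P)`: the indices `α` such that every block of `P` meets both `I_α` and `J_α`. -/
def compatIdx {N : ℕ} {ι : Type} (S : Finset ι) (I J : ι → Finset (Fin N))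
    (L : List (Fin N × Fin N)) : Finset ι :=
  S.filter (fun α => ∀ p ∈ L,
    (p.1 ∈ I α ∨ p.2 ∈ I α) ∧ (p.1 ∈ J α ∨ p.2 ∈ J α))

/-- The sign of moving the entry `a` past the elements of `X` below it. -/
def insertSign {N : ℕ} (X : Finset (Fin N)) (a : Fin N) : ℝ :=
  (-1) ^ (X.filter (· < a)).card

lemma insertSign_mul_self {N : ℕ} (X : Finset (Fin N)) (a : Fin N) :
    insertSign X a * insertSign X a = 1 := by
  rw [insertSign, ← mul_pow]; norm_num

lemma insertSign_ne_zero {N : ℕ} (X : Finset (Fin N)) (a : Fin N) : insertSign X a ≠ 0 := by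
  unfold insertSign; positivity

lemma insertSign_insert {N : ℕ} {X : Finset (Fin N)} {a c : Fin N} (hc : c ∉ X) :
    insertSign (insert c X) a = (if c < a then -1 else 1) * insertSign X a := by
  unfold insertSign
  rw [filter_insert]
  split_ifs with h
  · rw [card_insert_of_notMem (by simp [hc]), pow_succ]; ring
  · ring

/-- The wedge product of the rows of `A` indexed by `X`, in increasing order. -/
noncomputable def wedge {N m : ℕ} (A : Matrix (Fin N) (Fin m) ℝ) (X : Finset (Fin N)) :
    ExteriorAlgebra ℝ (Fin m → ℝ) :=
  ((X.sort (· ≤ ·)).map (fun i => ExteriorAlgebra.ι ℝ (A i))).prod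

/-- The linear functional on the exterior algebra given by the determinant in top degree. -/
noncomputable def detForm (m : ℕ) : ExteriorAlgebra ℝ (Fin m → ℝ) →ₗ[ℝ] ℝ :=
  ExteriorAlgebra.liftAlternating fun k =>
    if h : k = m then (Matrix.detRowAlternating (R := ℝ) (n := Fin m)).domDomCongr (finCongr h.symm)
    else 0

lemma wedge_eq_ιMulti {N m k : ℕ} (A : Matrix (Fin N) (Fin m) ℝ) (X : Finset (Fin N))
    (h : X.card = k) :
    wedge A X = ExteriorAlgebra.ιMulti ℝ k (fun i => A (X.orderEmbOfFin h i)) := by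
  rw [ExteriorAlgebra.ιMulti_apply, wedge, ← listMap_orderEmbOfFin_finRange X h, List.map_map,
    List.ofFn_eq_map]
  rfl

lemma pluck_eq_detForm {N m : ℕ} (A : Matrix (Fin N) (Fin m) ℝ) (X : Finset (Fin N)) :
    pluck A X = detForm m (wedge A X) := by
  unfold pluck detForm
  split_ifs with h
  · subst h
    rw [wedge_eq_ιMulti A X rfl, ExteriorAlgebra.liftAlternating_apply_ιMulti]
    simp
    rfl
  · rw [wedge_eq_ιMulti A X rfl, ExteriorAlgebra.liftAlternating_apply_ιMulti]
    simp [h]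

lemma wedge_insert_of_lt {N m : ℕ} (A : Matrix (Fin N) (Fin m) ℝ) {X : Finset (Fin N)} {a : Fin N}
    (h : ∀ x ∈ X, a < x) :
    wedge A (insert a X) = ExteriorAlgebra.ι ℝ (A a) * wedge A X := by
  unfold wedge
  rw [sort_insert _ (fun b hb => (h b hb).le) (fun ha => lt_irrefl _ (h a ha))]
  simp

lemma wedge_insert {N m : ℕ} (A : Matrix (Fin N) (Fin m) ℝ) {X : Finset (Fin N)} {a : Fin N}
    (ha : a ∉ X) :
    wedge A (insert a X) = insertSign X a • (ExteriorAlgebra.ι ℝ (A a) * wedge A X) := by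
  induction X using Finset.induction_on_min with
  | empty => rw [wedge_insert_of_lt A (by simp)]; simp [insertSign]
  | insert c X hc ih =>
    have hcX : c ∉ X := fun h => lt_irrefl _ (hc c h)
    have hac : a ≠ c := fun h => ha (by simp [h])
    have haX : a ∉ X := fun h => ha (by simp [h])
    rcases lt_or_gt_of_ne hac with h | h
    · rw [wedge_insert_of_lt A (by
        intro x hx; rcases mem_insert.1 hx with rfl | hx
        exacts [h, h.trans (hc x hx)])]
      have : (insert c X).filter (· < a) = ∅ := by
        ext x
        simp only [mem_filter, mem_insert, notMem_empty, iff_false, not_and, not_lt]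
        rintro (rfl | hx)
        exacts [h.le, (h.trans (hc x hx)).le]
      simp [insertSign, this]
    · rw [Finset.insert_comm, wedge_insert_of_lt A (X := insert a X) (by
        intro x hx; rcases mem_insert.1 hx with rfl | hx
        exacts [h, hc x hx]), ih haX, wedge_insert_of_lt A hc, insertSign_insert hcX, if_pos h,
        mul_smul_comm, ← mul_assoc, ← mul_assoc,
        eq_neg_of_add_eq_zero_left (ExteriorAlgebra.ι_add_mul_swap (A a) (A c))]
      simp

lemma ι_mul_wedge_of_mem {N m : ℕ} (A : Matrix (Fin N) (Fin m) ℝ) {X : Finset (Fin N)} {a : Fin N}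
    (ha : a ∈ X) : ExteriorAlgebra.ι ℝ (A a) * wedge A X = 0 := by
  rw [← insert_erase ha, wedge_insert A (notMem_erase a X), mul_smul_comm, ← mul_assoc,
    ExteriorAlgebra.ι_sq_zero, zero_mul, smul_zero]

lemma wedge_updateRow {N m : ℕ} (A : Matrix (Fin N) (Fin m) ℝ) {X : Finset (Fin N)} {a : Fin N}
    (ha : a ∉ X) (w : Fin m → ℝ) : wedge (A.updateRow a w) X = wedge A X := by
  unfold wedge
  congr 1
  apply List.map_congr_left
  intro i hi
  have : i ≠ a := fun h => ha (by simpa [h] using hi)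
  rw [Matrix.updateRow_ne this]

/-- The determinant of `w` followed by the rows of `A` indexed by `X`, as a function of `w`. -/
noncomputable def headDet {N m : ℕ} (A : Matrix (Fin N) (Fin m) ℝ) (X : Finset (Fin N)) :
    (Fin m → ℝ) →ₗ[ℝ] ℝ :=
  detForm m ∘ₗ LinearMap.mulRight ℝ (wedge A X) ∘ₗ ExteriorAlgebra.ι ℝ

lemma headDet_apply {N m : ℕ} (A : Matrix (Fin N) (Fin m) ℝ) (X : Finset (Fin N))
    (w : Fin m → ℝ) : headDet A X w = detForm m (ExteriorAlgebra.ι ℝ w * wedge A X) := rfl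

lemma pluck_insert {N m : ℕ} (A : Matrix (Fin N) (Fin m) ℝ) {X : Finset (Fin N)} {a : Fin N}
    (ha : a ∉ X) : pluck A (insert a X) = insertSign X a * headDet A X (A a) := by
  rw [pluck_eq_detForm, wedge_insert A ha, map_smul, headDet_apply, smul_eq_mul]

lemma headDet_of_mem {N m : ℕ} (A : Matrix (Fin N) (Fin m) ℝ) {X : Finset (Fin N)} {a : Fin N}
    (ha : a ∈ X) : headDet A X (A a) = 0 := by
  rw [headDet_apply, ι_mul_wedge_of_mem A ha, map_zero]

lemma headDet_of_mem_span {N m : ℕ} (A : Matrix (Fin N) (Fin m) ℝ) {X : Finset (Fin N)}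
    {w : Fin m → ℝ} (hw : w ∈ Submodule.span ℝ (A '' (X : Set (Fin N)))) : headDet A X w = 0 := by
  have : Submodule.span ℝ (A '' (X : Set (Fin N))) ≤ LinearMap.ker (headDet A X) := by
    rw [Submodule.span_le]
    rintro _ ⟨a, ha, rfl⟩
    exact headDet_of_mem A ha
  exact this hw

/-- If a Plücker coordinate is nonzero, its rows span the whole space. -/
lemma exists_sum_of_pluck_ne_zero {N m : ℕ} (A : Matrix (Fin N) (Fin m) ℝ) {K : Finset (Fin N)}
    (hK : pluck A K ≠ 0) (w : Fin m → ℝ) : ∃ β : Fin N → ℝ, ∑ k ∈ K, β k • A k = w := by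
  suffices hw : w ∈ Submodule.span ℝ (A '' (K : Set (Fin N))) by
    exact (Submodule.mem_span_image_finset_iff_exists_fun' ℝ).1 hw
  unfold pluck at hK
  split_ifs at hK with h
  · set M := A.submatrix (fun k => ((K.orderIsoOfFin h) k : Fin N)) id
    have hw : Matrix.vecMul (Matrix.vecMul w M⁻¹) M = w := by
      rw [Matrix.vecMul_vecMul, Matrix.nonsing_inv_mul _ (isUnit_iff_ne_zero.2 hK),
        Matrix.vecMul_one]
    rw [← hw, Matrix.vecMul_eq_sum]
    refine Submodule.sum_mem _ fun i _ => Submodule.smul_mem _ _ (Submodule.subset_span ?_)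
    exact ⟨_, (K.orderIsoOfFin h i).2, rfl⟩
  · exact absurd rfl hK

lemma insertSign_mul_insertSign {N : ℕ} {X : Finset (Fin N)} {a b : Fin N} (hab : a < b)
    (ha : a ∉ X) :
    insertSign X b * insertSign X a = (-1) ^ (X.filter (fun x => a < x ∧ x < b)).card := by
  have : X.filter (· < b) = X.filter (· < a) ∪ X.filter (fun x => a < x ∧ x < b) := by
    ext x
    simp only [mem_filter, mem_union]
    have : x ∈ X → x ≠ a := fun h h' => ha (h' ▸ h)
    grind
  unfold insertSign
  rw [this, card_union_of_disjoint, pow_add, mul_right_comm, ← mul_pow]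
  · norm_num
  · rw [disjoint_left]; intro x; simp only [mem_filter]; grind

/-- Adding `s` times row `a` to row `b`, when `s` carries the appropriate sign. -/
lemma pluck_updateRow_add {N m : ℕ} (A : Matrix (Fin N) (Fin m) ℝ) {a b : Fin N} (hab : a ≠ b)
    {s t : ℝ}
    (hs : ∀ X, a ∉ X → b ∉ X → pluck A (insert a X) ≠ 0 →
      s * (insertSign X b * insertSign X a) = t) (K : Finset (Fin N)) :
    pluck (A.updateRow b (A b + s • A a)) K =
      pluck A K + if b ∈ K ∧ a ∉ K then t * pluck A (insert a (K.erase b)) else 0 := by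
  by_cases hb : b ∈ K
  · obtain ⟨X, hX, rfl⟩ : ∃ X, b ∉ X ∧ insert b X = K := ⟨K.erase b, by simp, insert_erase hb⟩
    rw [pluck_insert _ hX, pluck_insert _ hX, erase_insert hX, Matrix.updateRow_self,
      headDet_apply, wedge_updateRow A hX, ← headDet_apply, map_add, map_smul, smul_eq_mul]
    by_cases ha : a ∈ X
    · rw [headDet_of_mem A ha]; simp [ha]
    · rw [if_pos (by simp [ha, hab])]
      by_cases h0 : pluck A (insert a X) = 0
      · rw [h0, mul_zero]
        rw [pluck_insert A ha] at h0
        rw [(mul_eq_zero.1 h0).resolve_left (insertSign_ne_zero X a)]; ring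
      · rw [← hs X ha hX h0, pluck_insert A ha]
        linear_combination (-(insertSign X b) * s * headDet A X (A a)) *
          insertSign_mul_self X a
  · rw [pluck_eq_detForm, wedge_updateRow A hb, ← pluck_eq_detForm]; simp [hb]

/-- A noncrossing matching of the non-fixed points of `μ`. -/
def IsNoncrossing {N : ℕ} (μ : Fin N → Fin N) : Prop :=
  (∀ i, μ (μ i) = i) ∧ ∀ i j, i < j → j < μ i → ¬ μ i < μ j

/-- The pair `(I, J)` agrees with `T` on the fixed points of `μ`, and each pair of matched points
has one element in `I ∖ J` and the other in `J ∖ I`. -/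
def Bichromatic {N : ℕ} (μ : Fin N → Fin N) (T I J : Finset (Fin N)) : Prop :=
  ∀ i, (μ i = i → (i ∈ I ↔ i ∈ T) ∧ (i ∈ J ↔ i ∈ T)) ∧
    (μ i ≠ i → (i ∈ J ↔ i ∉ I) ∧ (μ i ∈ I ↔ i ∉ I))

/-- The matching with `a` and `b` interchanged. -/
def swapConj {N : ℕ} (μ : Fin N → Fin N) (a b : Fin N) (i : Fin N) : Fin N :=
  Equiv.swap a b (μ (Equiv.swap a b i))

/-- The matching with the additional block `{a, b}`. -/
def addBlock {N : ℕ} (μ : Fin N → Fin N) (a b : Fin N) (i : Fin N) : Fin N :=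
  if i = a then b else if i = b then a else μ i

/-- The matching with `a` and `b` removed and their partners matched with each other. -/
def fuse {N : ℕ} (μ : Fin N → Fin N) (a b : Fin N) (i : Fin N) : Fin N :=
  if i = a then a else if i = b then b else if i = μ a then μ b else if i = μ b then μ a else μ i

lemma IsNoncrossing.addBlock {N : ℕ} {μ : Fin N → Fin N} (h : IsNoncrossing μ) {a b : Fin N}
    (hab : a < b) (hbtw : ∀ i, a < i → i < b → μ i = i) (ha : μ a = a) (hb : μ b = b) :
    IsNoncrossing (addBlock μ a b) := by
  obtain ⟨h1, h2⟩ := h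
  refine ⟨fun i => ?_, fun i j => ?_⟩
  · have := h1 i
    unfold _root_.addBlock; grind
  · have := h1 i
    have := h1 j
    have := h2 i j
    have := hbtw i
    have := hbtw j
    unfold _root_.addBlock; grind

lemma IsNoncrossing.swapConj {N : ℕ} {μ : Fin N → Fin N} (h : IsNoncrossing μ) {a b : Fin N}
    (hab : a < b) (hbtw : ∀ i, a < i → i < b → μ i = i) (hfix : μ a = a ∨ μ b = b) :
    IsNoncrossing (swapConj μ a b) := by
  obtain ⟨h1, h2⟩ := h
  refine ⟨fun i => ?_, fun i j => ?_⟩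
  · simp [_root_.swapConj, h1]
  · have := h1 i
    have := h1 j
    have := h1 a
    have := h1 b
    have := h2 i j
    have := h2 i a
    have := h2 a j
    have := h2 b j
    have := h2 i b
    have := hbtw i
    have := hbtw j
    have := hbtw (μ i)
    have := hbtw (μ j)
    clear h1 h2 hbtw
    simp only [_root_.swapConj, Equiv.swap_apply_def]; grind (splits := 40)

lemma IsNoncrossing.fuse {N : ℕ} {μ : Fin N → Fin N} (h : IsNoncrossing μ) {a b : Fin N}
    (hab : a < b) (hbtw : ∀ i, a < i → i < b → μ i = i) (ha : μ a ≠ a) (hb : μ b ≠ b) :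
    IsNoncrossing (fuse μ a b) := by
  obtain ⟨h1, h2⟩ := h
  refine ⟨fun i => ?_, fun i j => ?_⟩
  · have := h1 i
    have := h1 a
    have := h1 b
    unfold _root_.fuse; grind
  · have := h1 i
    have := h1 j
    have := h1 a
    have := h1 b
    have := h2 i j
    have := h2 i a
    have := h2 a j
    have := h2 b j
    have := h2 i b
    have := h2 (μ a) j
    have := h2 i (μ a)
    have := h2 i (μ b)
    have := h2 (μ b) j
    have := h2 a i
    have := h2 b i
    have := h2 (μ a) i
    have := h2 (μ b) i
    have := h2 j a
    have := h2 j b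
    have := h2 j (μ a)
    have := h2 j (μ b)
    have := h2 a b
    have := h2 a (μ b)
    have := h2 (μ b) a
    have := h2 (μ a) b
    have := h2 b (μ a)
    have := hbtw i
    have := hbtw j
    have := hbtw (μ i)
    have := hbtw (μ j)
    clear h1 h2 hbtw
    unfold _root_.fuse; grind (splits := 40)

lemma Bichromatic.symm {N : ℕ} {μ : Fin N → Fin N} (hμ : ∀ i, μ (μ i) = i)
    {T I J : Finset (Fin N)} (h : Bichromatic μ T I J) : Bichromatic μ T J I := by
  intro i
  have := h i
  have := h (μ i)
  have := hμ i
  grind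

lemma bichromatic_comm {N : ℕ} {μ : Fin N → Fin N} (hμ : ∀ i, μ (μ i) = i)
    {T I J : Finset (Fin N)} : Bichromatic μ T I J ↔ Bichromatic μ T J I :=
  ⟨.symm hμ, .symm hμ⟩

/-- Moving the element `a` to `b` with weight `t`. -/
def moveSet {N : ℕ} (a b : Fin N) (t : ℝ) (g : Finset (Fin N) → ℝ) (K : Finset (Fin N)) : ℝ :=
  g K + if b ∈ K ∧ a ∉ K then t * g (insert a (K.erase b)) else 0

/-- Moving `a` to `b` with weight `t` in both arguments. -/
def movePair {N : ℕ} (a b : Fin N) (t : ℝ) (F : Finset (Fin N) → Finset (Fin N) → ℝ)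
    (I J : Finset (Fin N)) : ℝ :=
  moveSet a b t (fun I' => moveSet a b t (F I') J) I

open Classical in
/-- The indicator function of the pairs compatible with a matching. -/
noncomputable def matchFun {N : ℕ} (μ : Fin N → Fin N) (T I J : Finset (Fin N)) : ℝ :=
  if Bichromatic μ T I J then 1 else 0

/-- The cone generated by the indicators of noncrossing matchings that fix `Z` pointwise. -/
noncomputable def matchCone {N : ℕ} (Z : Set (Fin N)) :
    Submodule NNReal (Finset (Fin N) → Finset (Fin N) → ℝ) :=
  Submodule.span NNReal
    {F | ∃ μ T, IsNoncrossing μ ∧ (∀ i ∈ Z, μ i = i) ∧ F = matchFun μ T}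

lemma matchFun_mem_matchCone {N : ℕ} {Z : Set (Fin N)} {μ : Fin N → Fin N} (h : IsNoncrossing μ)
    (hZ : ∀ i ∈ Z, μ i = i) (T : Finset (Fin N)) : matchFun μ T ∈ matchCone Z :=
  Submodule.subset_span ⟨μ, T, h, hZ, rfl⟩

section Cases

variable {N : ℕ} {μ : Fin N → Fin N} {a b : Fin N} {T I J : Finset (Fin N)}

lemma bichromatic_move_fuse (hμ : ∀ i, μ (μ i) = i) (hab : a ≠ b) (ha : μ a ≠ a) (hb : μ b ≠ b) :
    ((b ∈ I ∧ a ∉ I) ∧ Bichromatic μ T (insert a (I.erase b)) J) ↔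
      Bichromatic (fuse μ a b) (insert b (T.erase a)) I J ∧ (μ a = b ∨ μ a ∈ J) := by
  have h1 := hμ a
  have h2 := hμ b
  constructor
  · rintro ⟨hI, h⟩
    have h3 := h a
    have h4 := h b
    have h5 := h (μ a)
    have h6 := h (μ b)
    refine ⟨fun i => ?_, ?_⟩
    · have h7 := h i
      have h8 := hμ i
      clear hμ h
      unfold fuse
      simp only [mem_insert, mem_erase] at *
      grind (splits := 40)
    · clear hμ h
      simp only [mem_insert, mem_erase] at *
      grind (splits := 40)
  · rintro ⟨h, h'⟩
    have h3 := h a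
    have h4 := h b
    have h5 := h (μ a)
    have h6 := h (μ b)
    refine ⟨?_, fun i => ?_⟩
    · clear hμ h
      unfold fuse at *
      simp only [mem_insert, mem_erase] at *
      grind (splits := 40)
    · have h7 := h i
      have h8 := hμ i
      clear hμ h
      unfold fuse at *
      simp only [mem_insert, mem_erase] at *
      grind (splits := 40)

lemma bichromatic_move_right (hμ : ∀ i, μ (μ i) = i) (hab : a ≠ b) (ha : μ a ≠ a) (hb : μ b = b)
    (hbT : b ∉ T) :
    ((b ∈ I ∧ a ∉ I) ∧ Bichromatic μ T (insert a (I.erase b)) J) ↔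
      Bichromatic (swapConj μ a b) (T.erase a) I J ∧ b ∈ I := by
  have h1 := hμ a
  have h2 := hμ b
  constructor
  · rintro ⟨hI, h⟩
    have h3 := h a
    have h4 := h b
    have h5 := h (μ a)
    refine ⟨fun i => ?_, hI.1⟩
    have h7 := h i
    have h8 := hμ i
    clear hμ h
    simp only [swapConj, Equiv.swap_apply_def]
    simp only [mem_insert, mem_erase] at *
    grind (splits := 40)
  · rintro ⟨h, h'⟩
    have h3 := h a
    have h4 := h b
    have h5 := h (μ a)
    simp only [swapConj, Equiv.swap_apply_def] at h3 h4 h5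
    refine ⟨?_, fun i => ?_⟩
    · clear hμ h
      simp only [mem_erase] at *
      grind (splits := 40)
    · have h7 := h i
      have h8 := hμ i
      clear hμ h
      simp only [swapConj, Equiv.swap_apply_def] at h7
      simp only [mem_insert, mem_erase] at *
      grind (splits := 40)

lemma bichromatic_move_left (hμ : ∀ i, μ (μ i) = i) (hab : a ≠ b) (ha : μ a = a) (hb : μ b ≠ b)
    (haT : a ∈ T) :
    ((b ∈ I ∧ a ∉ I) ∧ Bichromatic μ T (insert a (I.erase b)) J) ↔
      Bichromatic (swapConj μ a b) (insert b (T.erase a)) I J ∧ a ∉ I := by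
  have h1 := hμ a
  have h2 := hμ b
  constructor
  · rintro ⟨hI, h⟩
    have h3 := h a
    have h4 := h b
    have h5 := h (μ b)
    refine ⟨fun i => ?_, hI.2⟩
    have h7 := h i
    have h8 := hμ i
    clear hμ h
    simp only [swapConj, Equiv.swap_apply_def]
    simp only [mem_insert, mem_erase] at *
    grind (splits := 40)
  · rintro ⟨h, h'⟩
    have h3 := h a
    have h4 := h b
    have h5 := h (μ b)
    simp only [swapConj, Equiv.swap_apply_def] at h3 h4 h5
    refine ⟨?_, fun i => ?_⟩
    · clear hμ h
      simp only [mem_insert, mem_erase] at *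
      grind (splits := 40)
    · have h7 := h i
      have h8 := hμ i
      clear hμ h
      simp only [swapConj, Equiv.swap_apply_def] at h7
      simp only [mem_insert, mem_erase] at *
      grind (splits := 40)

lemma bichromatic_move_addBlock (hμ : ∀ i, μ (μ i) = i) (hab : a ≠ b) (ha : μ a = a)
    (hb : μ b = b) (haT : a ∈ T) (hbT : b ∉ T) :
    ((b ∈ I ∧ a ∉ I) ∧ Bichromatic μ T (insert a (I.erase b)) J) ↔
      Bichromatic (addBlock μ a b) T I J ∧ b ∈ I := by
  constructor
  · rintro ⟨hI, h⟩
    have h3 := h a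
    have h4 := h b
    refine ⟨fun i => ?_, hI.1⟩
    have h7 := h i
    have h8 := hμ i
    clear hμ h
    unfold addBlock
    simp only [mem_insert, mem_erase] at *
    grind (splits := 40)
  · rintro ⟨h, h'⟩
    have h3 := h a
    have h4 := h b
    refine ⟨?_, fun i => ?_⟩
    · clear hμ h
      unfold addBlock at *
      grind (splits := 40)
    · have h7 := h i
      have h8 := hμ i
      clear hμ h
      unfold addBlock at *
      simp only [mem_insert, mem_erase] at *
      grind (splits := 40)

lemma bichromatic_move_both (hμ : ∀ i, μ (μ i) = i) (hab : a ≠ b) (ha : μ a = a) (hb : μ b = b) (haT : a ∈ T)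
    (hbT : b ∉ T) :
    ((b ∈ I ∧ a ∉ I) ∧ (b ∈ J ∧ a ∉ J) ∧
      Bichromatic μ T (insert a (I.erase b)) (insert a (J.erase b))) ↔
      Bichromatic μ (insert b (T.erase a)) I J := by
  constructor
  · rintro ⟨hI, hJ, h⟩ i
    have h3 := h a
    have h4 := h b
    have h7 := h i
    have h8 := h (μ i)
    have h9 := hμ i
    clear h hμ
    simp only [mem_insert, mem_erase] at *
    grind (splits := 40)
  · intro h
    have h3 := h a
    have h4 := h b
    refine ⟨?_, ?_, fun i => ?_⟩
    · simp only [mem_insert, mem_erase] at *; grind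
    · simp only [mem_insert, mem_erase] at *; grind
    · have h7 := h i
      have h8 := h (μ i)
      have h9 := hμ i
      clear h hμ
      simp only [mem_insert, mem_erase] at *
      grind (splits := 40)

end Cases

section MovePair

variable {N : ℕ} {μ : Fin N → Fin N} {a b : Fin N} {T I J : Finset (Fin N)} {t : ℝ}

lemma smul_mem_matchCone {Z : Set (Fin N)} {F : Finset (Fin N) → Finset (Fin N) → ℝ} (ht : 0 ≤ t)
    (hF : F ∈ matchCone Z) : t • F ∈ matchCone Z :=
  (matchCone Z).smul_mem ⟨t, ht⟩ hF

open Classical in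
lemma movePair_matchFun : movePair a b t (matchFun μ T) I J =
    matchFun μ T I J +
      t * (if (b ∈ I ∧ a ∉ I) ∧ Bichromatic μ T (insert a (I.erase b)) J then 1 else 0) +
      t * (if (b ∈ J ∧ a ∉ J) ∧ Bichromatic μ T I (insert a (J.erase b)) then 1 else 0) +
      t ^ 2 * (if (b ∈ I ∧ a ∉ I) ∧ (b ∈ J ∧ a ∉ J) ∧
        Bichromatic μ T (insert a (I.erase b)) (insert a (J.erase b)) then 1 else 0) := by
  unfold movePair moveSet matchFun
  by_cases hI : b ∈ I ∧ a ∉ I <;> by_cases hJ : b ∈ J ∧ a ∉ J <;>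
    simp only [hI, hJ, true_and, false_and, if_true, if_false, not_false_eq_true, and_self] <;> ring

open Classical in
lemma movePair_matchFun_of_iff {μ' : Fin N → Fin N} {T' : Finset (Fin N)}
    {side : Finset (Fin N) → Finset (Fin N) → Prop} {k : ℝ} (hμ : ∀ i, μ (μ i) = i)
    (hμ' : ∀ i, μ' (μ' i) = i)
    (h : ∀ I J, ((b ∈ I ∧ a ∉ I) ∧ Bichromatic μ T (insert a (I.erase b)) J) ↔
      Bichromatic μ' T' I J ∧ side I J)
    (hk : ∀ I J, Bichromatic μ' T' I J →
      (if side I J then 1 else 0) + (if side J I then 1 else 0) = k) :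
    movePair a b t (matchFun μ T) I J = matchFun μ T I J + t * k * matchFun μ' T' I J +
      t ^ 2 * (if (b ∈ I ∧ a ∉ I) ∧ (b ∈ J ∧ a ∉ J) ∧
        Bichromatic μ T (insert a (I.erase b)) (insert a (J.erase b)) then 1 else 0) := by
  have h2 : ((b ∈ J ∧ a ∉ J) ∧ Bichromatic μ T I (insert a (J.erase b))) ↔
      Bichromatic μ' T' I J ∧ side J I := by
    rw [bichromatic_comm hμ, h, bichromatic_comm hμ']
  rw [movePair_matchFun, if_congr (h I J) rfl rfl, if_congr h2 rfl rfl]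
  by_cases hB : Bichromatic μ' T' I J
  · rw [← hk I J hB]
    simp only [matchFun, hB, true_and, if_true]
    ring
  · simp [matchFun, hB]

open Classical in
lemma movePair_matchFun_of_iff_of_ne {μ' : Fin N → Fin N} {T' : Finset (Fin N)}
    {side : Finset (Fin N) → Finset (Fin N) → Prop} {k : ℝ} (hμ : ∀ i, μ (μ i) = i)
    (hμ' : ∀ i, μ' (μ' i) = i) (hne : μ a ≠ a ∨ μ b ≠ b)
    (h : ∀ I J, ((b ∈ I ∧ a ∉ I) ∧ Bichromatic μ T (insert a (I.erase b)) J) ↔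
      Bichromatic μ' T' I J ∧ side I J)
    (hk : ∀ I J, Bichromatic μ' T' I J →
      (if side I J then 1 else 0) + (if side J I then 1 else 0) = k) :
    movePair a b t (matchFun μ T) = matchFun μ T + (t * k) • matchFun μ' T' := by
  funext I J
  rw [movePair_matchFun_of_iff hμ hμ' h hk, if_neg]
  · simp
  · rintro ⟨-, -, hB⟩
    have h3 := hB a
    have h4 := hB b
    simp only [mem_insert, mem_erase] at h3 h4
    grind

lemma movePair_matchFun_of_fixed_left (ha : μ a = a) (haT : a ∉ T) :
    movePair a b t (matchFun μ T) = matchFun μ T := by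
  have key : ∀ I J : Finset (Fin N), ¬ Bichromatic μ T (insert a I) J := fun I J hB => by
    have h3 := hB a
    simp only [mem_insert] at h3
    grind
  have key' : ∀ I J : Finset (Fin N), ¬ Bichromatic μ T I (insert a J) := fun I J hB => by
    have h3 := hB a
    simp only [mem_insert] at h3
    grind
  funext I J
  simp [movePair_matchFun, key, key']

lemma movePair_matchFun_of_fixed_right (hb : μ b = b) (hbT : b ∈ T) (hab : a ≠ b) :
    movePair a b t (matchFun μ T) = matchFun μ T := by
  have key : ∀ I J : Finset (Fin N), ¬ Bichromatic μ T (insert a (I.erase b)) J := fun I J hB => by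
    have h3 := hB b
    simp only [mem_insert, mem_erase] at h3
    grind
  have key' : ∀ I J : Finset (Fin N), ¬ Bichromatic μ T I (insert a (J.erase b)) := fun I J hB => by
    have h3 := hB b
    simp only [mem_insert, mem_erase] at h3
    grind
  funext I J
  simp [movePair_matchFun, key, key']

open Classical in
lemma movePair_matchFun_mem (hμ : IsNoncrossing μ) (hab : a < b)
    (hbtw : ∀ i ∈ Set.Ioo a b, μ i = i) (ht : 0 ≤ t) :
    movePair a b t (matchFun μ T) ∈ matchCone ∅ := by
  have hbtw' : ∀ i, a < i → i < b → μ i = i := fun i h1 h2 => hbtw i ⟨h1, h2⟩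
  have mem : ∀ {ν : Fin N → Fin N} (T), IsNoncrossing ν → matchFun ν T ∈ matchCone ∅ :=
    fun T h => matchFun_mem_matchCone h (by simp) T
  have hne := hab.ne
  by_cases ha : μ a = a
  · by_cases haT : a ∈ T
    · by_cases hb : μ b = b
      · by_cases hbT : b ∈ T
        · rw [movePair_matchFun_of_fixed_right hb hbT hne]
          exact mem T hμ
        · have hμ' := hμ.addBlock hab hbtw' ha hb
          have : movePair a b t (matchFun μ T) = matchFun μ T + (t * 1) • matchFun (addBlock μ a b) T +
              t ^ 2 • matchFun μ (insert b (T.erase a)) := by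
            funext I J
            rw [movePair_matchFun_of_iff (k := 1) hμ.1 hμ'.1
              (fun I J => bichromatic_move_addBlock hμ.1 hne ha hb haT hbT),
              if_congr (bichromatic_move_both hμ.1 hne ha hb haT hbT) rfl rfl]
            · rfl
            · intro I J h
              have := h b
              simp only [addBlock] at this
              grind
          rw [this]
          exact add_mem (add_mem (mem T hμ) (smul_mem_matchCone (by simpa) (mem T hμ')))
            (smul_mem_matchCone (by positivity) (mem _ hμ))
      · have hμ' := hμ.swapConj hab hbtw' (.inl ha)
        rw [movePair_matchFun_of_iff_of_ne (k := 1) hμ.1 hμ'.1 (.inr hb)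
          (fun I J => bichromatic_move_left hμ.1 hne ha hb haT)]
        · exact add_mem (mem T hμ) (smul_mem_matchCone (by simpa) (mem _ hμ'))
        · intro I J h
          have := h a
          have := hμ.1 b
          simp only [swapConj, Equiv.swap_apply_def] at *
          grind
    · rw [movePair_matchFun_of_fixed_left ha haT]
      exact mem T hμ
  · by_cases hb : μ b = b
    · by_cases hbT : b ∈ T
      · rw [movePair_matchFun_of_fixed_right hb hbT hne]
        exact mem T hμ
      · have hμ' := hμ.swapConj hab hbtw' (.inr hb)
        rw [movePair_matchFun_of_iff_of_ne (k := 1) hμ.1 hμ'.1 (.inl ha)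
          (fun I J => bichromatic_move_right hμ.1 hne ha hb hbT)]
        · exact add_mem (mem T hμ) (smul_mem_matchCone (by simpa) (mem _ hμ'))
        · intro I J h
          have := h b
          have := hμ.1 a
          simp only [swapConj, Equiv.swap_apply_def] at *
          grind
    · have hμ' := hμ.fuse hab hbtw' ha hb
      rw [movePair_matchFun_of_iff_of_ne (k := if μ a = b then 2 else 1) hμ.1 hμ'.1 (.inl ha)
        (fun I J => bichromatic_move_fuse hμ.1 hne ha hb)]
      · refine add_mem (mem T hμ) (smul_mem_matchCone ?_ (mem _ hμ'))
        split_ifs <;> simpa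
      · intro I J h
        have := h (μ a)
        have := hμ.1 a
        have := hμ.1 b
        simp only [fuse] at *
        by_cases hh : μ a = b
        · simp only [hh, true_or, if_true]; norm_num
        · grind

lemma movePair_add (F G : Finset (Fin N) → Finset (Fin N) → ℝ) :
    movePair a b t (F + G) = movePair a b t F + movePair a b t G := by
  funext I J
  simp only [movePair, moveSet, Pi.add_apply]
  split_ifs <;> ring

lemma movePair_smul (r : NNReal) (F : Finset (Fin N) → Finset (Fin N) → ℝ) :
    movePair a b t (r • F) = r • movePair a b t F := by
  funext I J
  simp only [movePair, moveSet, Pi.smul_apply, NNReal.smul_def, smul_eq_mul]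
  split_ifs <;> ring

lemma movePair_mem_matchCone {F : Finset (Fin N) → Finset (Fin N) → ℝ}
    (hF : F ∈ matchCone (Set.Ioo a b)) (hab : a < b) (ht : 0 ≤ t) :
    movePair a b t F ∈ matchCone ∅ := by
  induction hF using Submodule.span_induction with
  | mem F h =>
    obtain ⟨μ, T, hμ, hZ, rfl⟩ := h
    exact movePair_matchFun_mem hμ hab hZ ht
  | zero =>
    have : movePair a b t 0 = 0 := by funext I J; simp [movePair, moveSet]
    rw [this]
    exact zero_mem _
  | add F G _ _ hF hG =>
    rw [movePair_add]
    exact add_mem hF hG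
  | smul r F _ hF =>
    rw [movePair_smul]
    exact Submodule.smul_mem _ r hF

open Classical in
lemma mask_mem_matchCone {F : Finset (Fin N) → Finset (Fin N) → ℝ} (Z : Set (Fin N))
    (hF : F ∈ matchCone ∅) :
    (fun I J => if ∀ i ∈ Z, (i ∈ I ↔ i ∈ J) then F I J else 0) ∈ matchCone Z := by
  induction hF using Submodule.span_induction with
  | mem F h =>
    obtain ⟨μ, T, hμ, -, rfl⟩ := h
    by_cases hZ : ∀ i ∈ Z, μ i = i
    · convert matchFun_mem_matchCone hμ hZ T using 3 with I J
      simp only [matchFun, ite_eq_left_iff]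
      intro hm
      rw [if_neg]
      intro hB
      exact hm fun i hi => ((hB i).1 (hZ i hi)).1.trans ((hB i).1 (hZ i hi)).2.symm
    · convert (matchCone Z).zero_mem with I J
      push Not at hZ
      obtain ⟨i, hi, hμi⟩ := hZ
      simp only [matchFun]
      split_ifs with h1 h2
      · have := ((h2 i).2 hμi).1
        have := h1 i hi
        tauto
      · rfl
      · rfl
  | zero => convert (matchCone Z).zero_mem with I J; simp
  | add F G _ _ hF hG =>
    convert add_mem hF hG using 1
    funext I J
    simp only [Pi.add_apply]
    split_ifs <;> simp
  | smul r F _ hF =>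
    convert Submodule.smul_mem _ r hF using 1
    funext I J
    simp only [Pi.smul_apply]
    split_ifs <;> simp

end MovePair

section TotallyNonneg

variable {N m : ℕ} {A : Matrix (Fin N) (Fin m) ℝ}

lemma headDet_eq_of_sum {X K : Finset (Fin N)} {c : Fin N} {β : Fin N → ℝ} {w : Fin m → ℝ}
    (hw : ∑ k ∈ K, β k • A k = w) (hc : c ∈ K)
    (h : ∀ k ∈ K, k ≠ c → headDet A X (A k) = 0) :
    headDet A X w = β c * headDet A X (A c) := by
  rw [← hw, map_sum, sum_eq_single_of_mem c hc fun k hk hkc => by rw [map_smul, h k hk hkc, smul_zero],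
    map_smul, smul_eq_mul]

lemma headDet_eq_of_sum_insert {X : Finset (Fin N)} {c : Fin N} {β : Fin N → ℝ} {w : Fin m → ℝ}
    (hw : ∑ k ∈ insert c X, β k • A k = w) :
    headDet A X w = β c * headDet A X (A c) :=
  headDet_eq_of_sum hw (mem_insert_self c X) fun _ hk hkc =>
    headDet_of_mem A ((mem_insert.1 hk).resolve_left hkc)

lemma headDet_ne_zero_iff {X : Finset (Fin N)} {c : Fin N} (hc : c ∉ X) :
    headDet A X (A c) ≠ 0 ↔ pluck A (insert c X) ≠ 0 := by
  rw [pluck_insert A hc, mul_ne_zero_iff, and_iff_right (insertSign_ne_zero X c)]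

lemma nonneg_insertSign_mul {X : Finset (Fin N)} {c s : Fin N} {g : ℝ}
    (hA : ∀ K, 0 ≤ pluck A K) (hc : c ∉ X) (hs : s ∉ X) (hp : headDet A X (A c) ≠ 0)
    (h : headDet A X (A s) = g * headDet A X (A c)) :
    0 ≤ g * (insertSign X s * insertSign X c) := by
  have h1 := hA (insert s X)
  have h2 := hA (insert c X)
  rw [pluck_insert A hs, h] at h1
  rw [pluck_insert A hc] at h2
  have h3 : 0 < insertSign X c * headDet A X (A c) :=
    h2.lt_of_ne' (mul_ne_zero (insertSign_ne_zero X c) hp)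
  refine nonneg_of_mul_nonneg_left (?_ : 0 ≤ _ * (insertSign X c * headDet A X (A c))) h3
  have h4 := insertSign_mul_self X c
  calc 0 ≤ insertSign X s * (g * headDet A X (A c)) := h1
    _ = insertSign X s * (g * headDet A X (A c)) * (insertSign X c * insertSign X c) := by
      rw [h4, mul_one]
    _ = _ := by ring

lemma coeff_eq_zero {X : Finset (Fin N)} {a b s x : Fin N} {β γ : Fin N → ℝ}
    (hA : ∀ K, 0 ≤ pluck A K) (hab : a < b) (hbs : b < s) (hx : x < a ∨ s < x) (ha : a ∉ X)
    (hb : b ∉ X) (hs : s ∉ X) (hxX : x ∈ X) (hpa : pluck A (insert a X) ≠ 0)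
    (hpb : pluck A (insert b X) = 0) (hβ : ∑ k ∈ insert a X, β k • A k = A b) (hβx : β x ≠ 0)
    (hγ : ∑ k ∈ insert a X, γ k • A k = A s) : γ a = 0 := by
  obtain ⟨Y, hxY, rfl⟩ : ∃ Y, x ∉ Y ∧ X = insert x Y :=
    ⟨X.erase x, notMem_erase x X, (insert_erase hxX).symm⟩
  simp only [mem_insert, not_or] at ha hb hs
  have h1 := headDet_eq_of_sum_insert hγ
  have h2 : headDet A (insert a Y) (A b) = β x * headDet A (insert a Y) (A x) := by
    rw [insert_comm] at hβ
    exact headDet_eq_of_sum_insert hβ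
  have hbx : headDet A (insert b Y) (A x) = 0 := by
    by_contra h
    exact (headDet_ne_zero_iff (by simp [hxY, Ne.symm hb.1])).1 h (by rwa [insert_comm])
  have h4 : headDet A (insert b Y) (A a) ≠ 0 := by
    rw [headDet_ne_zero_iff (by simp [ha, hab.ne]), insert_comm,
      ← headDet_ne_zero_iff (by simp [hb, hab.ne']), h2]
    refine mul_ne_zero hβx ((headDet_ne_zero_iff (by simp [hxY, Ne.symm ha.1])).2 ?_)
    rwa [insert_comm]
  have h3 : headDet A (insert b Y) (A s) = γ a * headDet A (insert b Y) (A a) := by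
    refine headDet_eq_of_sum hγ (mem_insert_self _ _) fun k hk hka => ?_
    obtain rfl | hk := mem_insert.1 ((mem_insert.1 hk).resolve_left hka)
    · exact hbx
    · exact headDet_of_mem A (mem_insert_of_mem hk)
  have n1 := nonneg_insertSign_mul hA (by simp [ha]) (by simp [hs])
    ((headDet_ne_zero_iff (by simp [ha])).2 hpa) h1
  have n2 := nonneg_insertSign_mul hA (by simp [ha, hab.ne]) (by simp [hs, hbs.ne']) h4 h3
  have hne := mul_ne_zero (insertSign_ne_zero Y s) (insertSign_ne_zero Y a)
  rw [insertSign_insert hxY, insertSign_insert hxY] at n1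
  rw [insertSign_insert hb.2, insertSign_insert hb.2, if_pos hbs, if_neg hab.not_gt] at n2
  have hss : (if x < s then (-1 : ℝ) else 1) * (if x < a then -1 else 1) = 1 := by
    rcases hx with hx | hx
    · rw [if_pos hx, if_pos (hx.trans (hab.trans hbs))]; norm_num
    · rw [if_neg hx.not_gt, if_neg (hab.trans (hbs.trans hx)).not_gt]; norm_num
  have : γ a * (insertSign Y s * insertSign Y a) = 0 := by
    refine le_antisymm (by linarith) ?_
    calc _ ≤ _ := n1
      _ = γ a * (insertSign Y s * insertSign Y a) *
          ((if x < s then (-1 : ℝ) else 1) * (if x < a then -1 else 1)) := by ring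
      _ = _ := by rw [hss, mul_one]
  exact (mul_eq_zero.1 this).resolve_right hne

/-- The element `e` lies in some but not all of the bases of `A`. -/
def IsFree (A : Matrix (Fin N) (Fin m) ℝ) (e : Fin N) : Prop :=
  (∃ K, pluck A K ≠ 0 ∧ e ∈ K) ∧ ∃ K, pluck A K ≠ 0 ∧ e ∉ K

lemma pluck_exchange {K : Finset (Fin N)} {β : Fin N → ℝ} {w k : Fin N} (hK : pluck A K ≠ 0)
    (hβ : ∑ k ∈ K, β k • A k = A w) (hw : w ∉ K) (hk : k ∈ K) (hβk : β k ≠ 0) :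
    pluck A (insert w (K.erase k)) ≠ 0 := by
  rw [← insert_erase hk] at hβ hK
  rw [← headDet_ne_zero_iff (fun h => hw (mem_of_mem_erase h)), headDet_eq_of_sum_insert hβ]
  exact mul_ne_zero hβk ((headDet_ne_zero_iff (notMem_erase k K)).2 hK)

lemma IsFree.of_exchange {K : Finset (Fin N)} {β : Fin N → ℝ} {w k : Fin N} (hK : pluck A K ≠ 0)
    (hβ : ∑ k ∈ K, β k • A k = A w) (hw : w ∉ K) (hk : k ∈ K) (hβk : β k ≠ 0) : IsFree A k :=
  ⟨⟨K, hK, hk⟩, _, pluck_exchange hK hβ hw hk hβk, by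
    simp only [mem_insert, mem_erase, ne_eq, not_true_eq_false, false_and, or_false]
    rintro rfl
    exact hw hk⟩

lemma IsFree.row_ne_zero {e : Fin N} (he : IsFree A e) : A e ≠ 0 := by
  obtain ⟨⟨K, hK, heK⟩, -⟩ := he
  rw [← insert_erase heK, ← headDet_ne_zero_iff (notMem_erase e K)] at hK
  intro h
  rw [h, map_zero] at hK
  exact hK rfl

end TotallyNonneg

section Adjacent

variable {N m : ℕ} {A : Matrix (Fin N) (Fin m) ℝ}

lemma card_eq_of_pluck_ne_zero {K : Finset (Fin N)} (hK : pluck A K ≠ 0) : K.card = m := by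
  unfold pluck at hK
  split_ifs at hK with h
  · exact h
  · exact absurd rfl hK

lemma exists_isFree {K₁ K₂ : Finset (Fin N)} (h₁ : pluck A K₁ ≠ 0) (h₂ : pluck A K₂ ≠ 0)
    (hne : K₁ ≠ K₂) : ∃ e, IsFree A e := by
  have hcard := (card_eq_of_pluck_ne_zero h₁).trans (card_eq_of_pluck_ne_zero h₂).symm
  obtain ⟨e, he₁, he₂⟩ := not_subset.1 fun hs => hne (eq_of_subset_of_card_le hs hcard.ge)
  exact ⟨e, ⟨K₁, h₁, he₁⟩, K₂, h₂, he₂⟩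

/-- The row `a` is spanned by the free rows with index greater than `a` and less than `b`. -/
def SpannedBelow (A : Matrix (Fin N) (Fin m) ℝ) (a : Fin N) (b : ℕ) : Prop :=
  IsFree A a ∧ A a ∈ Submodule.span ℝ (A '' {s | IsFree A s ∧ a < s ∧ s.val < b})

lemma IsFree.exists_spannedBelow {e : Fin N} (he : IsFree A e) : ∃ a, SpannedBelow A a N := by
  obtain ⟨K, hK, heK⟩ := he.2
  obtain ⟨β, hβ⟩ := exists_sum_of_pluck_ne_zero A hK (A e)
  have hC : (insert e (K.filter (β · ≠ 0))).Nonempty := insert_nonempty _ _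
  obtain ⟨a, haC, hamin⟩ : ∃ a ∈ insert e (K.filter (β · ≠ 0)),
      ∀ c ∈ insert e (K.filter (β · ≠ 0)), a ≤ c :=
    ⟨_, min'_mem _ hC, fun c hc => min'_le _ c hc⟩
  have hfree : ∀ k ∈ K, β k ≠ 0 → IsFree A k := fun k hk hβk => .of_exchange hK hβ heK hk hβk
  have hmem : ∀ k ∈ K, k ≠ a → β k • A k ∈
      Submodule.span ℝ (A '' {s | IsFree A s ∧ a < s ∧ s.val < N}) := by
    intro k hk hka
    by_cases hβk : β k = 0
    · simp [hβk]
    · refine Submodule.smul_mem _ _ (Submodule.subset_span ⟨k, ⟨hfree k hk hβk, ?_, k.2⟩, rfl⟩)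
      exact lt_of_le_of_ne (hamin k (by simp [hk, hβk])) hka.symm
  obtain rfl | ha := mem_insert.1 haC
  · refine ⟨a, he, ?_⟩
    rw [← hβ]
    exact Submodule.sum_mem _ fun k hk => hmem k hk (by rintro rfl; exact heK hk)
  · obtain ⟨haK, hβa⟩ := mem_filter.1 ha
    refine ⟨a, hfree a haK hβa, ?_⟩
    rw [← Submodule.smul_mem_iff _ hβa]
    have h1 : β a • A a = A e - ∑ k ∈ K.erase a, β k • A k := by
      rw [← hβ, ← add_sum_erase K _ haK, add_sub_cancel_right]
    have hne : e ≠ a := by rintro rfl; exact heK haK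
    rw [h1]
    refine Submodule.sub_mem _ (Submodule.subset_span ⟨e, ⟨he, ?_, e.2⟩, rfl⟩)
      (Submodule.sum_mem _ fun k hk => hmem k (mem_of_mem_erase hk) (ne_of_mem_erase hk))
    exact lt_of_le_of_ne (hamin e (mem_insert_self _ _)) hne.symm

lemma SpannedBelow.exists_lt {a : Fin N} {b : ℕ} (h : SpannedBelow A a b) :
    ∃ s, IsFree A s ∧ a < s ∧ s.val < b := by
  by_contra hs
  have hle : Submodule.span ℝ (A '' {s | IsFree A s ∧ a < s ∧ s.val < b}) ≤ ⊥ := by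
    rw [Submodule.span_le]
    rintro _ ⟨s, h, rfl⟩
    exact (hs ⟨s, h⟩).elim
  exact h.1.row_ne_zero ((Submodule.mem_bot ℝ).1 (hle h.2))

lemma SpannedBelow.exchange {a b : Fin N} {c : ℕ} (hA : ∀ K, 0 ≤ pluck A K)
    (h : SpannedBelow A a c) (hmin : ¬ SpannedBelow A b (c - 1)) (hab : a < b) (hb : IsFree A b)
    (hbtw : ∀ s, a < s → s < b → ¬ IsFree A s) {X : Finset (Fin N)} (ha : a ∉ X) (hbX : b ∉ X)
    (hpa : pluck A (insert a X) ≠ 0) : pluck A (insert b X) ≠ 0 := by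
  intro hpb
  have hb' : b ∉ insert a X := by simp [hbX, hab.ne']
  obtain ⟨β, hβ⟩ := exists_sum_of_pluck_ne_zero A hpa (A b)
  have hβa : β a = 0 := by
    by_contra hβa
    have := pluck_exchange hpa hβ hb' (mem_insert_self a X) hβa
    rw [erase_insert ha] at this
    exact this hpb
  have hbspan : A b ∈ Submodule.span ℝ (A '' (X : Set (Fin N))) := by
    rw [← hβ, sum_insert ha, hβa, zero_smul, zero_add]
    exact Submodule.sum_mem _ fun k hk => Submodule.smul_mem _ _ (Submodule.subset_span ⟨k, hk, rfl⟩)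
  obtain ⟨x, hxX, hβx, hx⟩ : ∃ x ∈ X, β x ≠ 0 ∧ (x < a ∨ c ≤ x.val + 1) := by
    by_contra! hx
    refine hmin ⟨hb, ?_⟩
    rw [← hβ, sum_insert ha, hβa, zero_smul, zero_add]
    refine Submodule.sum_mem _ fun k hk => ?_
    by_cases hβk : β k = 0
    · simp [hβk]
    · have hkf : IsFree A k := .of_exchange hpa hβ hb' (mem_insert_of_mem hk) hβk
      obtain ⟨h1, h2⟩ := hx k hk hβk
      have hka : k ≠ a := by rintro rfl; exact ha hk
      have hkb : k ≠ b := by rintro rfl; exact hbX hk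
      have hbk : b < k := by
        by_contra hbk
        exact hbtw k (lt_of_le_of_ne h1 hka.symm) (lt_of_le_of_ne (not_lt.1 hbk) hkb) hkf
      exact Submodule.smul_mem _ _ (Submodule.subset_span ⟨k, ⟨hkf, hbk, by omega⟩, rfl⟩)
  have hspan : Submodule.span ℝ (A '' {s | IsFree A s ∧ a < s ∧ s.val < c}) ≤
      Submodule.span ℝ (A '' (X : Set (Fin N))) := by
    rw [Submodule.span_le]
    rintro _ ⟨s, ⟨hsf, has, hsc⟩, rfl⟩
    by_cases hsX : s ∈ X
    · exact Submodule.subset_span ⟨s, hsX, rfl⟩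
    obtain rfl | hsb := eq_or_ne s b
    · exact hbspan
    have hbs : b < s := by
      by_contra hbs
      exact hbtw s has (lt_of_le_of_ne (not_lt.1 hbs) hsb) hsf
    have hxs : x ≠ s := by rintro rfl; exact hsX hxX
    have hx' : x < a ∨ s < x := hx.imp_right fun hcx => by
      have : x.val ≠ s.val := fun h => hxs (Fin.ext h)
      exact Fin.lt_def.2 (by omega)
    obtain ⟨γ, hγ⟩ := exists_sum_of_pluck_ne_zero A hpa (A s)
    have hγa := coeff_eq_zero hA hab hbs hx' ha hbX hsX hxX hpa hpb hβ hβx hγ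
    rw [SetLike.mem_coe, ← hγ, sum_insert ha, hγa, zero_smul, zero_add]
    exact Submodule.sum_mem _ fun k hk => Submodule.smul_mem _ _ (Submodule.subset_span ⟨k, hk, rfl⟩)
  exact (headDet_ne_zero_iff ha).2 hpa (headDet_of_mem_span A (hspan h.2))

lemma exists_adjacent (hA : ∀ K, 0 ≤ pluck A K) {K₁ K₂ : Finset (Fin N)} (h₁ : pluck A K₁ ≠ 0)
    (h₂ : pluck A K₂ ≠ 0) (hne : K₁ ≠ K₂) :
    ∃ a b, a < b ∧ IsFree A a ∧ IsFree A b ∧ (∀ s, a < s → s < b → ¬ IsFree A s) ∧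
      ∀ X, a ∉ X → b ∉ X → pluck A (insert a X) ≠ 0 → pluck A (insert b X) ≠ 0 := by
  classical
  obtain ⟨e, he⟩ := exists_isFree h₁ h₂ hne
  have hex : ∃ c a, SpannedBelow A a c := ⟨N, he.exists_spannedBelow⟩
  obtain ⟨a, ha⟩ := Nat.find_spec hex
  set c := Nat.find hex
  obtain ⟨s, hsf, has, hsc⟩ := ha.exists_lt
  have hB : (univ.filter fun s => IsFree A s ∧ a < s).Nonempty := ⟨s, by simp [hsf, has]⟩
  obtain ⟨b, hbB, hbmin⟩ := exists_min_image _ id hB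
  simp only [mem_filter, mem_univ, true_and, id, and_imp] at hbB hbmin
  refine ⟨a, b, hbB.2, ha.1, hbB.1, fun s h1 h2 h3 => (hbmin s h3 h1).not_gt h2, fun X haX hbX hp =>
    ha.exchange hA (fun h => ?_) hbB.2 hbB.1 (fun s h1 h2 h3 => (hbmin s h3 h1).not_gt h2) haX hbX hp⟩
  exact Nat.find_min hex (show c - 1 < c by omega) ⟨b, h⟩

end Adjacent

section Reduction

variable {N m : ℕ} {A : Matrix (Fin N) (Fin m) ℝ}

lemma mem_iff_of_not_isFree {e : Fin N} (he : ¬ IsFree A e) {K K' : Finset (Fin N)}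
    (hK : pluck A K ≠ 0) (hK' : pluck A K' ≠ 0) : e ∈ K ↔ e ∈ K' := by
  constructor
  · intro h
    by_contra h'
    exact he ⟨⟨K, hK, h⟩, K', hK', h'⟩
  · intro h
    by_contra h'
    exact he ⟨⟨K', hK', h⟩, K, hK, h'⟩

lemma exists_pluck_insert_ne_zero {a b : Fin N} (hab : a ≠ b) (ha : IsFree A a)
    (hb : IsFree A b) : ∃ X, a ∉ X ∧ b ∉ X ∧ pluck A (insert a X) ≠ 0 := by
  obtain ⟨K, hK, haK, hbK⟩ : ∃ K, pluck A K ≠ 0 ∧ a ∈ K ∧ b ∉ K := by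
    obtain ⟨⟨K₁, hK₁, haK₁⟩, -⟩ := ha
    obtain ⟨-, K₂, hK₂, hbK₂⟩ := hb
    by_cases hbK₁ : b ∈ K₁
    · have h1 : headDet A (K₁.erase b) (A b) ≠ 0 := by
        rw [headDet_ne_zero_iff (notMem_erase b K₁), insert_erase hbK₁]
        exact hK₁
      obtain ⟨β, hβ⟩ := exists_sum_of_pluck_ne_zero A hK₂ (A b)
      rw [← hβ, map_sum] at h1
      obtain ⟨k, hk, hk'⟩ := exists_ne_zero_of_sum_ne_zero h1
      rw [map_smul, smul_eq_mul] at hk'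
      have hk'' := right_ne_zero_of_mul hk'
      have hkX : k ∉ K₁.erase b := fun h => hk'' (headDet_of_mem A h)
      have hkb : b ≠ k := by rintro rfl; exact hbK₂ hk
      exact ⟨_, (headDet_ne_zero_iff hkX).1 hk'', by simp [haK₁, hab], by simp [hkb]⟩
    · exact ⟨K₁, hK₁, haK₁, hbK₁⟩
  exact ⟨K.erase a, notMem_erase a K, fun h => hbK (mem_of_mem_erase h), by rwa [insert_erase haK]⟩

lemma exists_reduction (hA : ∀ K, 0 ≤ pluck A K) {K₁ K₂ : Finset (Fin N)} (h₁ : pluck A K₁ ≠ 0)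
    (h₂ : pluck A K₂ ≠ 0) (hne : K₁ ≠ K₂) :
    ∃ (A' : Matrix (Fin N) (Fin m) ℝ) (a b : Fin N) (t : ℝ), a < b ∧ 0 ≤ t ∧
      (∀ K, 0 ≤ pluck A' K) ∧ pluck A = moveSet a b t (pluck A') ∧
      (univ.filter fun K => pluck A' K ≠ 0) ⊂ (univ.filter fun K => pluck A K ≠ 0) ∧
      ∀ K K', pluck A' K ≠ 0 → pluck A' K' ≠ 0 → ∀ i ∈ Set.Ioo a b, (i ∈ K ↔ i ∈ K') := by
  obtain ⟨a, b, hab, haf, hbf, hbtw, hex⟩ := exists_adjacent hA h₁ h₂ hne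
  obtain ⟨X₁, hX₁⟩ := exists_pluck_insert_ne_zero hab.ne haf hbf
  obtain ⟨X₀, hX₀, hmin⟩ := exists_min_image
    (univ.filter fun X => a ∉ X ∧ b ∉ X ∧ pluck A (insert a X) ≠ 0)
    (fun X => pluck A (insert b X) / pluck A (insert a X)) ⟨X₁, by simpa using hX₁⟩
  simp only [mem_filter, mem_univ, true_and, and_imp] at hX₀ hmin
  obtain ⟨ha₀, hb₀, hp₀⟩ := hX₀
  set t := pluck A (insert b X₀) / pluck A (insert a X₀) with ht
  have ht0 : 0 ≤ t := div_nonneg (hA _) (hA _)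
  set σ := insertSign X₀ b * insertSign X₀ a with hσ
  have hσσ : σ * σ = 1 := by
    have h1 := insertSign_mul_self X₀ a
    have h2 := insertSign_mul_self X₀ b
    calc σ * σ = (insertSign X₀ b * insertSign X₀ b) * (insertSign X₀ a * insertSign X₀ a) := by
          rw [hσ]; ring
      _ = 1 := by rw [h1, h2, one_mul]
  have hagree : ∀ K K', pluck A K ≠ 0 → pluck A K' ≠ 0 → ∀ i ∈ Set.Ioo a b, (i ∈ K ↔ i ∈ K') :=
    fun K K' hK hK' i hi => mem_iff_of_not_isFree (hbtw i hi.1 hi.2) hK hK'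
  have key := pluck_updateRow_add A hab.ne (s := -(t * σ)) (t := -t) fun X ha hb hp => by
    have : insertSign X b * insertSign X a = σ := by
      rw [hσ, insertSign_mul_insertSign hab ha, insertSign_mul_insertSign hab ha₀]
      congr 2
      ext i
      simp only [mem_filter, and_congr_left_iff]
      intro hi
      simpa [hi.1.ne'] using hagree _ _ hp hp₀ i hi
    rw [this, neg_mul, mul_assoc, hσσ, mul_one]
  set A' := A.updateRow b (A b + -(t * σ) • A a)
  have hA' : ∀ K, 0 ≤ pluck A' K := fun K => by
    rw [key]
    split_ifs with h
    · have hle := hmin (K.erase b) (fun h' => h.2 (mem_of_mem_erase h')) (notMem_erase b K)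
      rw [insert_erase h.1] at hle
      by_cases hp : pluck A (insert a (K.erase b)) = 0
      · simpa [hp] using hA K
      · have := hle hp
        rw [le_div_iff₀ ((hA _).lt_of_ne' hp)] at this
        linarith
    · simpa using hA K
  have hsub : ∀ K, pluck A' K ≠ 0 → pluck A K ≠ 0 := fun K hK hK0 => by
    refine hK (le_antisymm ?_ (hA' K))
    rw [key, hK0, zero_add]
    split_ifs with h
    · rw [neg_mul, neg_nonpos]
      exact mul_nonneg ht0 (hA _)
    · exact le_rfl
  refine ⟨A', a, b, t, hab, ht0, hA', ?_, ?_, fun K K' hK hK' => hagree K K' (hsub K hK) (hsub K' hK')⟩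
  · funext K
    rw [moveSet, key, key]
    by_cases h : b ∈ K ∧ a ∉ K
    · simp [h]
    · simp [h]
  · refine (ssubset_iff_of_subset fun K => by simpa using hsub K).2 ⟨insert b X₀, ?_, ?_⟩
    · simpa using hex X₀ ha₀ hb₀ hp₀
    · simp only [mem_filter, mem_univ, true_and, not_not]
      rw [key, if_pos ⟨mem_insert_self b X₀, by simp [ha₀, hab.ne]⟩, erase_insert hb₀, ht]
      field_simp
      ring

end Reduction

section Cone

variable {N m : ℕ}

lemma isNoncrossing_id : IsNoncrossing (id : Fin N → Fin N) :=
  ⟨fun _ => rfl, fun _ _ h h' => (lt_asymm h h').elim⟩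

lemma bichromatic_id_iff {T I J : Finset (Fin N)} : Bichromatic id T I J ↔ I = T ∧ J = T := by
  simp only [Bichromatic, id, forall_const, ne_eq, not_true_eq_false, false_imp_iff, and_true,
    forall_and, Finset.ext_iff]

theorem pluck_mul_pluck_mem_matchCone (A : Matrix (Fin N) (Fin m) ℝ) (hA : ∀ K, 0 ≤ pluck A K) :
    (fun I J => pluck A I * pluck A J) ∈ matchCone ∅ := by
  classical
  induction hs : (univ.filter fun K => pluck A K ≠ 0) using Finset.strongInduction
    generalizing A with
  | H s ih =>
  by_cases hne : ∃ K₁ K₂, pluck A K₁ ≠ 0 ∧ pluck A K₂ ≠ 0 ∧ K₁ ≠ K₂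
  · obtain ⟨K₁, K₂, h₁, h₂, hne⟩ := hne
    obtain ⟨A', a, b, t, hab, ht, hA', hmove, hss, hagree⟩ := exists_reduction hA h₁ h₂ hne
    have hmem : (fun I J => pluck A' I * pluck A' J) ∈ matchCone (Set.Ioo a b) := by
      convert mask_mem_matchCone (Set.Ioo a b) (ih _ (hs ▸ hss) A' hA' rfl) using 1
      funext I J
      split_ifs with h
      · rfl
      · by_contra h0
        exact h (hagree I J (left_ne_zero_of_mul h0) (right_ne_zero_of_mul h0))
    convert movePair_mem_matchCone hmem hab ht using 1
    rw [hmove]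
    funext I J
    simp only [movePair, moveSet]
    split_ifs <;> ring
  · push Not at hne
    by_cases hK : ∃ K, pluck A K ≠ 0
    · obtain ⟨K, hK⟩ := hK
      convert smul_mem_matchCone (mul_self_nonneg (pluck A K))
        (matchFun_mem_matchCone isNoncrossing_id (Z := ∅) (by simp) K) using 1
      funext I J
      simp only [Pi.smul_apply, matchFun, bichromatic_id_iff, smul_eq_mul]
      split_ifs with h
      · rw [h.1, h.2, mul_one]
      · rw [mul_zero]
        by_contra h0
        exact h ⟨hne _ _ (left_ne_zero_of_mul h0) hK, hne _ _ (right_ne_zero_of_mul h0) hK⟩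
    · push Not at hK
      convert (matchCone ∅).zero_mem with I J
      simp [hK]

end Cone

section Compat

variable {N m : ℕ}

lemma Compat.mem {D : Finset (Fin N)} {L : List (Fin N × Fin N)} (h : Compat D L) :
    ∀ p ∈ L, p.1 ∈ D ∧ p.2 ∈ D := by
  induction L generalizing D with
  | nil => simp
  | cons q L ih =>
    intro p hp
    obtain rfl | hp := List.mem_cons.1 hp
    · exact ⟨h.1.1, h.1.2.1⟩
    · exact (ih h.2 p hp).imp (fun h => (mem_sdiff.1 h).1) fun h => (mem_sdiff.1 h).1

lemma Compat.card_eq {D : Finset (Fin N)} {L : List (Fin N × Fin N)} (h : Compat D L) :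
    D.card = 2 * L.length := by
  induction L generalizing D with
  | nil => simpa [Compat] using h
  | cons q L ih =>
    have hsub : ({q.1, q.2} : Finset (Fin N)) ⊆ D := by
      simp [insert_subset_iff, h.1.1, h.1.2.1]
    have := card_sdiff_add_card_eq_card hsub
    rw [ih h.2, card_pair h.1.2.2.1] at this
    rw [List.length_cons, ← this]
    ring

lemma IsNoncrossing.removeBlock {μ : Fin N → Fin N} (hμ : IsNoncrossing μ) (u : Fin N) :
    IsNoncrossing fun i => if i = u ∨ i = μ u then i else μ i := by
  refine ⟨fun i => ?_, fun i j => ?_⟩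
  · have h1 := hμ.1 i
    have h2 := hμ.1 u
    clear hμ
    simp only
    split_ifs <;> grind
  · have h1 := hμ.2 i j
    clear hμ
    simp only
    split_ifs <;> grind

lemma IsNoncrossing.exists_compat {μ : Fin N → Fin N} (hμ : IsNoncrossing μ)
    {D : Finset (Fin N)} (hD : ∀ i, i ∈ D ↔ μ i ≠ i) :
    ∃ L, Compat D L ∧ (∀ p ∈ L, p.2 = μ p.1) ∧ ∀ i ∈ D, ∃ p ∈ L, i = p.1 ∨ i = p.2 := by
  induction D using Finset.strongInduction generalizing μ with
  | H D ih =>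
  obtain rfl | ⟨i, hi⟩ := D.eq_empty_or_nonempty
  · exact ⟨[], rfl, by simp, by simp⟩
  obtain ⟨u, hu, hmin⟩ := exists_min_image (D.filter fun u => u < μ u)
    (fun u => (μ u).val - u.val) (by
      obtain h | h := lt_or_gt_of_ne ((hD i).1 hi)
      · refine ⟨μ i, ?_⟩
        rw [mem_filter, hD, hμ.1]
        exact ⟨h.ne', h⟩
      · exact ⟨i, mem_filter.2 ⟨hi, h⟩⟩)
  simp only [mem_filter, hD, and_imp] at hu hmin
  have hcons : ConsecIn D u (μ u) := by
    refine ⟨(hD u).2 hu.1, (hD _).2 (by rw [hμ.1]; exact hu.1.symm), hu.2.ne, fun w hw => ?_⟩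
    rw [min_eq_left hu.2.le, max_eq_right hu.2.le]
    rintro ⟨h1, h2⟩
    have hw := (hD w).1 hw
    have a1 := hμ.2 u w h1 h2
    have a2 := hμ.2 (μ w) u
    have a3 := hmin w
    have a4 := hmin (μ w)
    have a5 := hμ.1 w
    have a6 := hμ.1 u
    simp only [Fin.lt_def, Fin.ext_iff, ne_eq] at *
    grind
  obtain ⟨L, hL1, hL2, hL3⟩ := ih (D \ {u, μ u})
    (sdiff_ssubset (by simp [insert_subset_iff, hcons.1, hcons.2.1]) (insert_nonempty _ _))
    (μ := fun i => if i = u ∨ i = μ u then i else μ i)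
    (hμ.removeBlock u)
    (fun i => by
      rw [mem_sdiff, hD, mem_insert, mem_singleton]
      split_ifs with h
      · simp [h]
      · simp [h])
  refine ⟨(u, μ u) :: L, ⟨hcons, hL1⟩, ?_, fun i hi => ?_⟩
  · intro p hp
    obtain rfl | hp := List.mem_cons.1 hp
    · rfl
    · have h1 := (hL1.mem p hp).1
      simp only [mem_sdiff, mem_insert, mem_singleton] at h1
      rw [hL2 p hp, if_neg h1.2]
  · by_cases h : i ∈ D \ {u, μ u}
    · obtain ⟨p, hp, hip⟩ := hL3 i h
      exact ⟨p, List.mem_cons_of_mem _ hp, hip⟩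
    · refine ⟨_, List.mem_cons_self, ?_⟩
      simpa [hi, or_iff_not_imp_left] using h

open Classical in
lemma exists_pluck_eq_ite_eq {T : Finset (Fin N)} (hT : T.card = m) :
    ∃ A : Matrix (Fin N) (Fin m) ℝ, ∀ K, pluck A K = if K = T then 1 else 0 := by
  let A : Matrix (Fin N) (Fin m) ℝ := fun i =>
    if h : i ∈ T then Pi.single ((T.orderIsoOfFin hT).symm ⟨i, h⟩) 1 else 0
  refine ⟨A, fun K => ?_⟩
  split_ifs with hKT
  · subst hKT
    rw [pluck, dif_pos hT]
    convert Matrix.det_one (n := Fin m) (R := ℝ)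
    ext i j
    have hi : ((K.orderIsoOfFin hT i : K) : Fin N) ∈ K := (K.orderIsoOfFin hT i).2
    have hrow : A (K.orderIsoOfFin hT i) = Pi.single i 1 := by
      rw [show A (K.orderIsoOfFin hT i) = _ from dif_pos hi, Subtype.coe_eta,
        OrderIso.symm_apply_apply]
    rw [Matrix.submatrix_apply, id, hrow, Pi.single_apply, Matrix.one_apply]
    simp only [eq_comm]
  · by_contra! hp
    have hcard := (card_eq_of_pluck_ne_zero hp).trans hT.symm
    obtain ⟨i, hiK, hiT⟩ := not_subset.1 fun hs => hKT (eq_of_subset_of_card_le hs hcard.ge)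
    rw [← insert_erase hiK, ← headDet_ne_zero_iff (notMem_erase i K)] at hp
    have hAi : A i = 0 := dif_neg hiT
    rw [hAi, map_zero] at hp
    exact hp rfl

open Classical in
lemma Compat.exists_matrix {D T : Finset (Fin N)} {L : List (Fin N × Fin N)} (h : Compat D L)
    (hTD : Disjoint T D) (hm : T.card + L.length = m) :
    ∃ A : Matrix (Fin N) (Fin m) ℝ, ∀ K, pluck A K =
      if (∀ i ∉ D, (i ∈ K ↔ i ∈ T)) ∧ ∀ p ∈ L, (p.1 ∈ K ↔ p.2 ∉ K) then 1 else 0 := by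
  induction L generalizing D T with
  | nil =>
    obtain rfl : D = ∅ := h
    simpa [Finset.ext_iff] using exists_pluck_eq_ite_eq (N := N) (T := T) (by simpa using hm)
  | cons q L ih =>
    obtain ⟨u, v⟩ := q
    obtain ⟨⟨hu, hv, huv, hbtw⟩, hL⟩ := h
    simp only at hu hv huv hbtw hL
    have huT : u ∉ T := fun h => (disjoint_left.1 hTD h) hu
    have hvT : v ∉ T := fun h => (disjoint_left.1 hTD h) hv
    obtain ⟨A, hA⟩ := ih (T := insert u T) hL
      (by
        rw [disjoint_left] at hTD ⊢
        intro i hi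
        simp only [mem_insert, mem_sdiff, mem_singleton] at hi ⊢
        rintro ⟨h1, h2⟩
        exact hi.elim (fun h => h2 (.inl h)) fun h => hTD h h1)
      (by rw [card_insert_of_notMem huT, ← hm, List.length_cons]; ring)
    have hmemL := hL.mem
    simp only [mem_sdiff, mem_insert, mem_singleton] at hA hmemL
    have hne : ∀ p ∈ L, (p.1 ≠ u ∧ p.1 ≠ v) ∧ p.2 ≠ u ∧ p.2 ≠ v := fun p hp => by
      have := hmemL p hp
      tauto
    have hs : ∀ X, u ∉ X → v ∉ X → pluck A (insert u X) ≠ 0 →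
        (-1) ^ (T.filter fun x => min u v < x ∧ x < max u v).card *
          (insertSign X v * insertSign X u) = 1 := by
      intro X huX hvX hp
      rw [hA] at hp
      have hp := (ite_ne_right_iff.1 hp).1.1
      have hXT : (T.filter fun x => min u v < x ∧ x < max u v) =
          X.filter fun x => min u v < x ∧ x < max u v := by
        ext i
        simp only [mem_filter, and_congr_left_iff]
        intro hi
        have hiu : i ≠ u := by rintro rfl; simp at hi; exact lt_asymm hi.1 hi.2
        have := hp i fun h => hbtw i h.1 hi
        simp only [mem_insert, hiu, false_or] at this
        exact this.symm
      have hsign : insertSign X v * insertSign X u =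
          (-1) ^ (X.filter fun x => min u v < x ∧ x < max u v).card := by
        obtain h | h := lt_or_gt_of_ne huv
        · rw [insertSign_mul_insertSign h huX, min_eq_left h.le, max_eq_right h.le]
        · rw [mul_comm, insertSign_mul_insertSign h hvX, min_eq_right h.le, max_eq_left h.le]
      rw [hXT, hsign, ← mul_pow]
      norm_num
    refine ⟨_, fun K => (pluck_updateRow_add A huv hs K).trans ?_⟩
    rw [hA, hA]
    have h1 : ∀ p ∈ L, ((p.1 ∈ insert u (K.erase v) ↔ p.2 ∉ insert u (K.erase v)) ↔
        (p.1 ∈ K ↔ p.2 ∉ K)) := fun p hp => by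
      have := hne p hp
      simp [mem_insert, mem_erase, this]
    simp only [forall₂_congr h1, List.forall_mem_cons]
    by_cases hrest : ∀ p ∈ L, (p.1 ∈ K ↔ p.2 ∉ K)
    · have e1 : (∀ i, ¬ (i ∈ D ∧ ¬ (i = u ∨ i = v)) → (i ∈ K ↔ i = u ∨ i ∈ T)) ↔
          (∀ i ∉ D, (i ∈ K ↔ i ∈ T)) ∧ u ∈ K ∧ v ∉ K := by
        grind
      have e2 : v ∈ K → u ∉ K → ((∀ i, ¬ (i ∈ D ∧ ¬ (i = u ∨ i = v)) →
          (i ∈ insert u (K.erase v) ↔ i = u ∨ i ∈ T)) ↔ ∀ i ∉ D, (i ∈ K ↔ i ∈ T)) := by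
        grind
      simp only [eq_true hrest, e1]
      by_cases huK : u ∈ K <;> by_cases hvK : v ∈ K
      · simp [huK, hvK]
      · simp [huK, hvK]
      · simp only [e2 hvK huK]
        simp [huK, hvK]
      · simp [huK, hvK]
    · simp only [eq_false hrest, and_false, if_false, mul_zero, ite_self, add_zero]

lemma rank_eq_of_pluck_ne_zero {A : Matrix (Fin N) (Fin m) ℝ} {K : Finset (Fin N)}
    (hK : pluck A K ≠ 0) : A.rank = m := by
  rw [Matrix.rank_eq_finrank_span_row]
  have : Submodule.span ℝ (Set.range A.row) = ⊤ := by
    rw [eq_top_iff]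
    intro w _
    obtain ⟨β, rfl⟩ := exists_sum_of_pluck_ne_zero A hK w
    exact Submodule.sum_mem _ fun k _ => Submodule.smul_mem _ _ (Submodule.subset_span ⟨k, rfl⟩)
  rw [this, finrank_top]
  simp

end Compat

lemma mem_and_mem_iff_of_val_add_eq {κ : Type*} {I J I' J' : Finset κ}
    (h : I.val + J.val = I'.val + J'.val) (i : κ) : i ∈ I ∧ i ∈ J ↔ i ∈ I' ∧ i ∈ J' := by
  classical
  have h1 := congrArg (Multiset.count i) h
  simp only [Multiset.count_add, Multiset.count_eq_of_nodup, I.nodup, J.nodup, I'.nodup, J'.nodup,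
    mem_val] at h1
  grind

lemma bichromatic_iff_forall_block {N : ℕ} {μ : Fin N → Fin N} {D T I J : Finset (Fin N)}
    {L : List (Fin N × Fin N)} (hμ : ∀ i, μ (μ i) = i) (hD : ∀ i, i ∈ D ↔ μ i ≠ i)
    (hL : ∀ p ∈ L, p.1 ∈ D) (hLμ : ∀ p ∈ L, p.2 = μ p.1)
    (hLD : ∀ i ∈ D, ∃ p ∈ L, i = p.1 ∨ i = p.2) (hIJ : ∀ i, i ∈ D ↔ ¬ (i ∈ I ↔ i ∈ J))
    (hT : ∀ i ∉ D, (i ∈ I ↔ i ∈ T) ∧ (i ∈ J ↔ i ∈ T)) :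
    Bichromatic μ T I J ↔ ∀ p ∈ L, (p.1 ∈ I ∨ p.2 ∈ I) ∧ (p.1 ∈ J ∨ p.2 ∈ J) := by
  have hμD : ∀ i, μ i ∈ D ↔ i ∈ D := fun i => by rw [hD, hD, hμ, ne_comm]
  refine ⟨fun h p hp => ?_, fun h i => ?_⟩
  · have h1 := (h p.1).2 ((hD _).1 (hL p hp))
    have h2 := (hIJ (μ p.1)).1 ((hμD _).2 (hL p hp))
    rw [hLμ p hp]
    tauto
  · refine ⟨fun hi => hT i fun hiD => (hD i).1 hiD hi, fun hi => ?_⟩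
    obtain ⟨p, hp, hip⟩ := hLD i ((hD i).2 hi)
    have h1 := h p hp
    have h2 := (hIJ p.1).1 (hL p hp)
    have h3 := (hIJ (μ p.1)).1 ((hμD _).2 (hL p hp))
    rw [hLμ p hp] at h1 hip
    obtain rfl | rfl := hip
    · tauto
    · rw [hμ]
      tauto

lemma sum_compatIdx_nonneg {N m : ℕ} {ι : Type} {S : Finset ι} {I J : ι → Finset (Fin N)}
    {c : ι → ℝ} {D : Finset (Fin N)} (hmemD : ∀ α ∈ S, ∀ i, i ∈ D ↔ ¬ (i ∈ I α ↔ i ∈ J α))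
    (hinter : ∀ α ∈ S, ∀ β ∈ S, ∀ i ∉ D, (i ∈ I α ↔ i ∈ I β) ∧ (i ∈ J α ↔ i ∈ J β))
    (hcard : ∀ α ∈ S, (I α).card = m ∧ (J α).card = m)
    (h : ∀ A : Matrix (Fin N) (Fin m) ℝ, A.rank = m → (∀ K, 0 ≤ pluck A K) →
      0 ≤ ∑ α ∈ S, c α * pluck A (I α) * pluck A (J α))
    {L : List (Fin N × Fin N)} (hL : Compat D L) : 0 ≤ ∑ α ∈ compatIdx S I J L, c α := by
  classical
  obtain hempty | ⟨α₀, hα₀⟩ := (compatIdx S I J L).eq_empty_or_nonempty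
  · simp [hempty]
  have hα₀S := (mem_filter.1 hα₀).1
  have hDeq : (I α₀ ∪ J α₀) \ (I α₀ ∩ J α₀) = D := by
    ext i
    rw [hmemD α₀ hα₀S]
    simp only [mem_sdiff, mem_union, mem_inter]
    tauto
  have hcards : (I α₀ ∩ J α₀).card + L.length = m := by
    have h1 := card_sdiff_add_card_eq_card (inter_subset_union (s := I α₀) (t := J α₀))
    have h2 := card_union_add_card_inter (I α₀) (J α₀)
    rw [hDeq, hL.card_eq] at h1
    have := hcard α₀ hα₀S
    omega
  obtain ⟨A, hA⟩ := hL.exists_matrix (T := I α₀ ∩ J α₀) (by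
    rw [← hDeq]
    exact disjoint_sdiff) hcards
  have hfix : ∀ α ∈ S, ∀ i ∉ D, (i ∈ I α ↔ i ∈ I α₀ ∩ J α₀) ∧ (i ∈ J α ↔ i ∈ I α₀ ∩ J α₀) :=
    fun α hα i hi => by
      have h1 := hinter α hα α₀ hα₀S i hi
      have h2 := hmemD α₀ hα₀S i
      rw [mem_inter]
      tauto
  have hblock : ∀ α ∈ S, ∀ p ∈ L,
      ((p.1 ∈ I α ↔ p.2 ∉ I α) ↔ (p.1 ∈ I α ∨ p.2 ∈ I α) ∧ (p.1 ∈ J α ∨ p.2 ∈ J α)) ∧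
      ((p.1 ∈ J α ↔ p.2 ∉ J α) ↔ (p.1 ∈ I α ∨ p.2 ∈ I α) ∧ (p.1 ∈ J α ∨ p.2 ∈ J α)) :=
    fun α hα p hp => by
      have h1 := (hmemD α hα p.1).1 (hL.mem p hp).1
      have h2 := (hmemD α hα p.2).1 (hL.mem p hp).2
      tauto
  have hval : ∀ α ∈ S, c α * pluck A (I α) * pluck A (J α) =
      if ∀ p ∈ L, (p.1 ∈ I α ∨ p.2 ∈ I α) ∧ (p.1 ∈ J α ∨ p.2 ∈ J α) then c α else 0 :=
    fun α hα => by
      have h1 := forall₂_congr fun p hp => (hblock α hα p hp).1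
      have h2 := forall₂_congr fun p hp => (hblock α hα p hp).2
      rw [hA, hA, if_congr ((and_iff_right fun i hi => (hfix α hα i hi).1).trans h1) rfl rfl,
        if_congr ((and_iff_right fun i hi => (hfix α hα i hi).2).trans h2) rfl rfl]
      split_ifs <;> simp
  have hrank : A.rank = m := by
    refine rank_eq_of_pluck_ne_zero (K := I α₀) ?_
    rw [hA, if_pos]
    · exact one_ne_zero
    · exact ⟨fun i hi => (hfix α₀ hα₀S i hi).1, fun p hp =>
        (hblock α₀ hα₀S p hp).1.2 ((mem_filter.1 hα₀).2 p hp)⟩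
  have hsum := h A hrank fun K => by rw [hA]; split_ifs <;> simp
  rw [sum_congr rfl hval, ← sum_filter] at hsum
  convert hsum using 2
  ext α
  simp only [compatIdx, mem_filter]

lemma sum_mul_pluck_mul_pluck_nonneg {N m : ℕ} {ι : Type} {S : Finset ι} {I J : ι → Finset (Fin N)}
    {c : ι → ℝ} {D : Finset (Fin N)} (hmemD : ∀ α ∈ S, ∀ i, i ∈ D ↔ ¬ (i ∈ I α ↔ i ∈ J α))
    (hinter : ∀ α ∈ S, ∀ β ∈ S, ∀ i ∉ D, (i ∈ I α ↔ i ∈ I β) ∧ (i ∈ J α ↔ i ∈ J β))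
    (h : ∀ L, Compat D L → 0 ≤ ∑ α ∈ compatIdx S I J L, c α)
    {A : Matrix (Fin N) (Fin m) ℝ} (hA : ∀ K, 0 ≤ pluck A K) :
    0 ≤ ∑ α ∈ S, c α * pluck A (I α) * pluck A (J α) := by
  classical
  suffices hF : ∀ F ∈ matchCone (N := N) ∅, 0 ≤ ∑ α ∈ S, c α * F (I α) (J α) by
    simpa only [mul_assoc] using hF _ (pluck_mul_pluck_mem_matchCone A hA)
  intro F hF
  induction hF using Submodule.span_induction with
  | mem F hF =>
    obtain ⟨μ, T, hμ, -, rfl⟩ := hF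
    by_cases hB : ∃ α ∈ S, Bichromatic μ T (I α) (J α)
    · obtain ⟨α₀, hα₀S, hB⟩ := hB
      have hD' : ∀ i, i ∈ D ↔ μ i ≠ i := fun i => by
        have := hB i
        rw [hmemD α₀ hα₀S i]
        tauto
      obtain ⟨L, hL, hLμ, hLD⟩ := hμ.exists_compat hD'
      convert h L hL using 1
      simp only [compatIdx, sum_filter, matchFun, mul_ite, mul_one, mul_zero]
      exact sum_congr rfl fun α hα => if_congr
        (bichromatic_iff_forall_block hμ.1 hD' (fun p hp => (hL.mem p hp).1) hLμ hLD
          (hmemD α hα) fun i hi => by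
            have h1 := (hB i).1 (not_not.1 (mt (hD' i).2 hi))
            have h2 := hinter α hα α₀ hα₀S i hi
            tauto) rfl rfl
    · push Not at hB
      rw [sum_eq_zero]
      intro α hα
      rw [matchFun, if_neg (hB α hα), mul_zero]
  | zero => simp
  | add F G _ _ hF hG =>
    simp only [Pi.add_apply, mul_add, sum_add_distrib]
    exact add_nonneg hF hG
  | smul r F _ hF =>
    have : ∑ α ∈ S, c α * (r • F) (I α) (J α) = r * ∑ α ∈ S, c α * F (I α) (J α) := by
      rw [mul_sum]
      refine sum_congr rfl fun α _ => ?_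
      simp only [Pi.smul_apply, NNReal.smul_def, smul_eq_mul]
      ring
    rw [this]
    exact mul_nonneg r.2 hF

/-- Classification via sums over 321-avoiding permutations: the quadratic Plücker inequality
holds over `Gr^{≥0}(m, m+n)` iff `∑_{α ∈ ℐ(P)} c_α ≥ 0` for every partition `P` of the common
symmetric difference `D = (I_α ∪ J_α) ∖ (I_α ∩ J_α)` compatible with a 321-avoiding
permutation. -/
theorem stmt_3 (m n η : ℕ) (hm : 1 ≤ m) (hmn : m ≤ n)
    {ι : Type} (S : Finset ι) (I J : ι → Finset (Fin (m + n))) (c : ι → ℝ)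
    (hcard : ∀ α ∈ S, (I α).card = m ∧ (J α).card = m)
    (hmulti : ∀ α ∈ S, ∀ β ∈ S, (I α).val + (J α).val = (I β).val + (J β).val)
    (D : Finset (Fin (m + n))) (hD : D.card = 2 * η)
    (hDeq : ∀ α ∈ S, (I α ∪ J α) \ (I α ∩ J α) = D) :
    (∀ A : Matrix (Fin (m + n)) (Fin m) ℝ, A.rank = m →
        (∀ K : Finset (Fin (m + n)), 0 ≤ pluck A K) →
        0 ≤ ∑ α ∈ S, c α * pluck A (I α) * pluck A (J α)) ↔
      (∀ L : List (Fin (m + n) × Fin (m + n)), Compat D L →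
        0 ≤ ∑ α ∈ compatIdx S I J L, c α) := by
  classical
  have hmemD : ∀ α ∈ S, ∀ i, i ∈ D ↔ ¬ (i ∈ I α ↔ i ∈ J α) := fun α hα i => by
    rw [← hDeq α hα]
    simp only [mem_sdiff, mem_union, mem_inter]
    tauto
  have hinter : ∀ α ∈ S, ∀ β ∈ S, ∀ i ∉ D,
      (i ∈ I α ↔ i ∈ I β) ∧ (i ∈ J α ↔ i ∈ J β) := fun α hα β hβ i hi => by
    have h1 := mem_and_mem_iff_of_val_add_eq (hmulti α hα β hβ) i
    have h2 := hmemD α hα i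
    have h3 := hmemD β hβ i
    tauto
  exact ⟨fun h L hL => sum_compatIdx_nonneg hmemD hinter hcard h hL,
    fun h A _ hA => sum_mul_pluck_mul_pluck_nonneg hmemD hinter h hA⟩
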